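/- For the 5-state 2-symbol Turing machine M with transition table δ(A,0)=(1,R,B), δ(A,1)=(0,L,D), δ(B,0)=(1,L,C), δ(B,1)=(1,R,D), δ(C,0)=(1,L,A), δ(C,1)=(1,L,C), δ(D,0)=(1,R,H), δ(D,1)=(1,R,E), δ(E,0)=(1,R,A), δ(E,1)=(0,R,B), and for every natural number k: from any configuration C(3k) the machine reaches a configuration C(5k+3) in exactly 10k²+10k+4 steps; from any configuration C(3k+1) it halts in exactly 3k+3 steps, the final tape reading left to right (all other cells blank): 1, then k consecutive blocks 1,1,0, then 1,1, with the halted head scanning a cell containing 0; and from any configuration C(3k+2) it reaches a configuration C(5k+7) in exactly 10k²+26k+12 steps. -/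

import Mathlib

/-- Move direction of the tape head. -/
inductive Dir : Type
  | L
  | R

/-- The head displacement of a direction. -/
def Dir.move : Dir → ℤ
  | Dir.L => -1
  | Dir.R => 1

/-- A Turing machine with `n` states and `k` symbols, in Rado's busy beaver model.
States are `Fin n` (state `A` is `0`, `B` is `1`, ...), symbols are `Fin k` with `0`
the blank symbol. A transition yields the written symbol, the move direction and the
next state, where `none` denotes the halting state `H`. -/
abbrev Machine (n k : ℕ) : Type :=
  Fin n → Fin k → Fin k × Dir × Option (Fin n)

/-- A configuration: current state (`none` = halted), head position, tape. -/
structure Cfg (n k : ℕ) where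
  state : Option (Fin n)
  pos : ℤ
  tape : ℤ → Fin k

/-- One computation step (halted configurations are fixed). -/
def step {n k : ℕ} (M : Machine n k) (c : Cfg n k) : Cfg n k :=
  match c.state with
  | none => c
  | some q =>
      { state := (M q (c.tape c.pos)).2.2
        pos := c.pos + (M q (c.tape c.pos)).2.1.move
        tape := Function.update c.tape c.pos (M q (c.tape c.pos)).1 }

/-- The initial configuration: state `A`, head at cell `0`, all-blank tape. -/
def init (n k : ℕ) [NeZero k] : Cfg n k :=
  { state := if h : 0 < n then some ⟨0, h⟩ else none
    pos := 0
    tape := fun _ => 0 }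

/-- `HaltsIn M c t`: started from `c`, the machine `M` halts after exactly `t` steps. -/
def HaltsIn {n k : ℕ} (M : Machine n k) (c : Cfg n k) (t : ℕ) : Prop :=
  ((step M)^[t] c).state = none ∧ ∀ i < t, ((step M)^[i] c).state ≠ none

/-- The number of non-blank cells of a configuration. -/
noncomputable def sigmaCount {n k : ℕ} [NeZero k] (c : Cfg n k) : ℕ :=
  Set.ncard {i : ℤ | c.tape i ≠ 0}

/-- Marxen and Buntrock's 5-state 2-symbol runner-up machine
(states `A,B,C,D,E` are `0,1,2,3,4`; `none` is the halting state `H`). -/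
def M : Machine 5 2 :=
  ![![(1, Dir.R, some 1), (0, Dir.L, some 3)],
    ![(1, Dir.L, some 2), (1, Dir.R, some 3)],
    ![(1, Dir.L, some 0), (1, Dir.L, some 2)],
    ![(1, Dir.R, none), (1, Dir.R, some 4)],
    ![(1, Dir.R, some 0), (0, Dir.R, some 1)]]

/-- The configuration `C(n)` with head at cell `p`: state `A`, scanned cell blank,
the `n` cells immediately to the right of the head all contain `1`, all other cells blank. -/
def Cf (n : ℕ) (p : ℤ) : Cfg 5 2 :=
  { state := some 0
    pos := p
    tape := fun i => if p < i ∧ i ≤ p + n then 1 else 0 }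

/-- The configuration in state `q` with head at `p`, where `l` lists the cells to the left of the
head (nearest first), `r` lists the cells from the scanned one rightwards, and all cells beyond
the two lists are blank. -/
def listCfg (q : Option (Fin 5)) (l r : List (Fin 2)) (p : ℤ) : Cfg 5 2 :=
  { state := q
    pos := p
    tape := fun i => if p ≤ i then r.getD (i - p).toNat 0 else l.getD (p - 1 - i).toNat 0 }

/-- Reachability in exactly `t` steps, up to the position of the head. -/
def Reach (t : ℕ) (q : Option (Fin 5)) (l r : List (Fin 2))
    (q' : Option (Fin 5)) (l' r' : List (Fin 2)) : Prop :=
  ∀ p, ∃ p', (step M)^[t] (listCfg q l r p) = listCfg q' l' r' p'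

theorem getD_blank (l : List (Fin 2)) (j : ℕ) :
    (l ++ [0]).getD j 0 = l.getD j 0 := by
  induction l generalizing j with
  | nil => cases j <;> simp
  | cons a l ih => cases j with
    | zero => simp
    | succ j => simpa using ih j

theorem listCfg_append_blank_right (q : Option (Fin 5)) (l r : List (Fin 2)) (p : ℤ) :
    listCfg q l (r ++ [0]) p = listCfg q l r p := by
  simp only [listCfg, getD_blank]

theorem listCfg_append_blank_left (q : Option (Fin 5)) (l r : List (Fin 2)) (p : ℤ) :
    listCfg q (l ++ [0]) r p = listCfg q l r p := by
  simp only [listCfg, getD_blank]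

theorem step_right {q : Fin 5} {s w : Fin 2} {q' : Option (Fin 5)} (h : M q s = (w, Dir.R, q'))
    (l r : List (Fin 2)) (p : ℤ) :
    step M (listCfg (some q) l (s :: r) p) = listCfg q' (w :: l) r (p + 1) := by
  simp only [step, listCfg, le_refl, sub_self, if_true, Int.toNat_zero, List.getD_cons_zero, h,
    Dir.move, Cfg.mk.injEq, true_and]
  funext i
  rcases lt_trichotomy i p with hi | rfl | hi
  · obtain ⟨j, rfl⟩ : ∃ j : ℕ, i = p - 1 - j := ⟨(p - 1 - i).toNat, by omega⟩
    rw [Function.update_of_ne hi.ne, if_neg (by omega), if_neg (by omega),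
      show (p - 1 - (p - 1 - (j : ℤ))).toNat = j by omega,
      show (p + 1 - 1 - (p - 1 - (j : ℤ))).toNat = j + 1 by omega, List.getD_cons_succ]
  · simp
  · obtain ⟨j, rfl⟩ : ∃ j : ℕ, i = p + 1 + j := ⟨(i - p - 1).toNat, by omega⟩
    rw [Function.update_of_ne hi.ne', if_pos (by omega), if_pos (by omega),
      show (p + 1 + (j : ℤ) - p).toNat = j + 1 by omega,
      show (p + 1 + (j : ℤ) - (p + 1)).toNat = j by omega, List.getD_cons_succ]

theorem step_left {q : Fin 5} {s w : Fin 2} {q' : Option (Fin 5)} (h : M q s = (w, Dir.L, q'))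
    (a : Fin 2) (l r : List (Fin 2)) (p : ℤ) :
    step M (listCfg (some q) (a :: l) (s :: r) p) = listCfg q' l (a :: w :: r) (p - 1) := by
  simp only [step, listCfg, le_refl, sub_self, if_true, Int.toNat_zero, List.getD_cons_zero, h,
    Dir.move, Cfg.mk.injEq, true_and]
  refine ⟨by ring, ?_⟩
  funext i
  rcases lt_trichotomy i p with hi | rfl | hi
  · rw [Function.update_of_ne hi.ne, if_neg (by omega)]
    obtain ⟨j, rfl⟩ : ∃ j : ℕ, i = p - 1 - j := ⟨(p - 1 - i).toNat, by omega⟩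
    cases j with
    | zero => simp
    | succ j =>
      rw [if_neg (by omega), show (p - 1 - (p - 1 - ((j + 1 : ℕ) : ℤ))).toNat = j + 1 by omega,
        show (p - 1 - 1 - (p - 1 - ((j + 1 : ℕ) : ℤ))).toNat = j by omega, List.getD_cons_succ]
  · simp
  · obtain ⟨j, rfl⟩ : ∃ j : ℕ, i = p + 1 + j := ⟨(i - p - 1).toNat, by omega⟩
    rw [Function.update_of_ne hi.ne', if_pos (by omega), if_pos (by omega),
      show (p + 1 + (j : ℤ) - p).toNat = j + 1 by omega,
      show (p + 1 + (j : ℤ) - (p - 1)).toNat = j + 2 by omega, List.getD_cons_succ,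
      List.getD_cons_succ, List.getD_cons_succ]

namespace Reach

variable {q q' q'' : Option (Fin 5)} {l r l' r' l'' r'' : List (Fin 2)} {s t : ℕ}

theorem refl : Reach 0 q l r q l r := fun p => ⟨p, rfl⟩

theorem trans (h₁ : Reach s q l r q' l' r') (h₂ : Reach t q' l' r' q'' l'' r'') :
    Reach (s + t) q l r q'' l'' r'' := by
  intro p
  obtain ⟨p', h₁⟩ := h₁ p
  obtain ⟨p'', h₂⟩ := h₂ p'
  exact ⟨p'', by rw [add_comm, Function.iterate_add_apply, h₁, h₂]⟩

theorem congr_steps (h : Reach s q l r q' l' r') (e : s = t) : Reach t q l r q' l' r' := e ▸ h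

theorem blank_right (h : Reach t q l [0] q' l' r') : Reach t q l [] q' l' r' := by
  intro p
  rw [← listCfg_append_blank_right]
  exact h p

theorem blank_left (h : Reach t q [0] r q' l' r') : Reach t q [] r q' l' r' := by
  intro p
  rw [← listCfg_append_blank_left]
  exact h p

theorem right {q : Fin 5} {s w : Fin 2} (h : M q s = (w, Dir.R, q'))
    (h' : Reach t q' (w :: l) r q'' l'' r'') : Reach (t + 1) (some q) l (s :: r) q'' l'' r'' := by
  intro p
  obtain ⟨p', h'⟩ := h' (p + 1)
  exact ⟨p', by rw [Function.iterate_succ_apply, step_right h, h']⟩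

theorem left {q : Fin 5} {s w a : Fin 2} (h : M q s = (w, Dir.L, q'))
    (h' : Reach t q' l (a :: w :: r) q'' l'' r'') :
    Reach (t + 1) (some q) (a :: l) (s :: r) q'' l'' r'' := by
  intro p
  obtain ⟨p', h'⟩ := h' (p - 1)
  exact ⟨p', by rw [Function.iterate_succ_apply, step_left h, h']⟩

end Reach

/-- A run of `n` ones followed by the list `l`. -/
def ones (n : ℕ) (l : List (Fin 2)) : List (Fin 2) := (List.cons 1)^[n] l

/-- The list `l` preceded by `k` copies of `0, 1, 1`. -/
def blocks (k : ℕ) (l : List (Fin 2)) : List (Fin 2) := (fun l => 0 :: 1 :: 1 :: l)^[k] l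

theorem ones_succ (n : ℕ) (l : List (Fin 2)) : ones (n + 1) l = 1 :: ones n l :=
  Function.iterate_succ_apply' ..

theorem ones_cons (n : ℕ) (l : List (Fin 2)) : ones n (1 :: l) = ones (n + 1) l :=
  (Function.iterate_succ_apply ..).symm

theorem blocks_succ (k : ℕ) (l : List (Fin 2)) :
    blocks (k + 1) l = 0 :: 1 :: 1 :: blocks k l :=
  Function.iterate_succ_apply' ..

theorem blocks_cons (k : ℕ) (l : List (Fin 2)) :
    blocks k (0 :: 1 :: 1 :: l) = blocks (k + 1) l :=
  (Function.iterate_succ_apply ..).symm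

theorem getD_ones (n j : ℕ) : (ones n []).getD j 0 = if j < n then 1 else 0 := by
  induction n generalizing j with
  | zero => simp [ones]
  | succ n ih =>
    rw [ones_succ]
    cases j with
    | zero => simp
    | succ j => simpa using ih j

theorem getD_blocks (k j : ℕ) :
    (blocks k [1]).getD j 0 = if (j < 3 * k ∧ j % 3 ≠ 0) ∨ j = 3 * k then 1 else 0 := by
  induction k generalizing j with
  | zero => cases j <;> simp [blocks]
  | succ k ih =>
    rw [blocks_succ]
    match j with
    | 0 => simp
    | 1 => simp; omega
    | 2 => simp; omega
    | j + 3 =>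
      simp only [List.getD_cons_succ, ih]
      exact if_congr (by omega) rfl rfl

theorem Cf_eq_listCfg (n : ℕ) (p : ℤ) : Cf n p = listCfg (some 0) [] (0 :: ones n []) p := by
  simp only [Cf, listCfg, Cfg.mk.injEq, true_and]
  funext i
  rcases lt_trichotomy i p with hi | rfl | hi
  · rw [if_neg (by omega), if_neg (by omega)]
    simp
  · simp
  · obtain ⟨j, rfl⟩ : ∃ j : ℕ, i = p + 1 + j := ⟨(i - p - 1).toNat, by omega⟩
    rw [if_pos (show p ≤ _ by omega), show (p + 1 + (j : ℤ) - p).toNat = j + 1 by omega,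
      List.getD_cons_succ, getD_ones]
    exact if_congr (by omega) rfl rfl

/-- State `B` turns each `111` into `110` while moving right. -/
theorem reach_B_blocks (k : ℕ) (l r : List (Fin 2)) :
    Reach (3 * k) (some 1) l (ones (3 * k) r) (some 1) (blocks k l) r := by
  induction k generalizing l with
  | zero => exact .refl
  | succ k ih =>
    rw [← blocks_cons, show 3 * (k + 1) = 3 * k + 1 + 1 + 1 by ring, ones_succ, ones_succ,
      ones_succ]
    exact .right rfl (.right rfl (.right rfl (ih _)))

/-- State `C` moves left over ones. -/
theorem reach_C_ones (n m : ℕ) (l : List (Fin 2)) :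
    Reach n (some 2) (ones n l) (1 :: ones m []) (some 2) l (1 :: ones (m + n) []) := by
  induction n generalizing m with
  | zero => exact .refl
  | succ n ih =>
    rw [ones_succ]
    refine .left rfl ?_
    rw [← ones_succ, show m + (n + 1) = m + 1 + n by ring]
    exact ih _

/-- State `A` moves right over ones when there is a one on its left. -/
theorem reach_A_ones (n : ℕ) (l r : List (Fin 2)) :
    Reach (3 * n) (some 0) (1 :: l) (ones n r) (some 0) (ones n (1 :: l)) r := by
  induction n generalizing l with
  | zero => exact .refl
  | succ n ih =>
    rw [ones_succ, ← ones_cons]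
    exact .left rfl (.right rfl (.right rfl (ih _)))

/-- One round trip, absorbing a block into the run of ones on the right. -/
theorem reach_C_round_trip (m : ℕ) (l : List (Fin 2)) :
    Reach (4 * m + 12) (some 2) (1 :: 1 :: l) (0 :: ones m [])
      (some 2) l (1 :: ones (m + 4) []) := by
  have hA : Reach 1 (some 2) (1 :: 1 :: l) (0 :: ones m []) (some 0) (1 :: l)
      (ones (m + 2) []) := by
    rw [ones_succ, ones_succ]
    exact .left rfl .refl
  have hC : Reach 2 (some 0) (ones (m + 2) (1 :: l)) [] (some 2) (ones (m + 2) (1 :: l))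
      (1 :: ones 1 []) :=
    .blank_right (.right rfl (.blank_right (.left rfl .refl)))
  have hs := reach_C_ones (m + 2 + 1) 1 l
  rw [← ones_cons, show 1 + (m + 2 + 1) = m + 4 by ring] at hs
  exact (((hA.trans (reach_A_ones _ _ _)).trans hC).trans hs).congr_steps (by ring)

/-- State `C` absorbs all the blocks on its left. -/
theorem reach_C_blocks (k m : ℕ) :
    Reach (10 * k ^ 2 + (4 * m + 7) * k + 3) (some 2) (blocks k [1]) (1 :: ones m [])
      (some 0) [] (0 :: ones (m + 5 * k + 3) []) := by
  induction k generalizing m with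
  | zero =>
    rw [show m + 5 * 0 + 3 = m + 1 + 1 + 1 by ring, ones_succ, ones_succ, ones_succ]
    exact .left rfl (.blank_left (.left rfl (.blank_left (.left rfl .refl))))
  | succ k ih =>
    rw [blocks_succ]
    have h := (reach_C_round_trip (m + 1) (blocks k [1])).trans (ih (m + 1 + 4))
    rw [ones_succ, show m + 1 + 4 + 5 * k + 3 = m + 5 * (k + 1) + 3 by ring] at h
    exact (Reach.left rfl h).congr_steps (by ring)

theorem reach_A_blocks (k : ℕ) (r : List (Fin 2)) :
    Reach (3 * k + 1) (some 0) [] (0 :: ones (3 * k) r) (some 1) (blocks k [1]) r :=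
  .right rfl (reach_B_blocks k [1] r)

theorem reach_of_mod_zero (k : ℕ) :
    Reach (10 * k ^ 2 + 10 * k + 4) (some 0) [] (0 :: ones (3 * k) [])
      (some 0) [] (0 :: ones (5 * k + 3) []) := by
  refine ((reach_A_blocks k []).trans (t := 10 * k ^ 2 + 7 * k + 3) ?_).congr_steps (by ring)
  cases k with
  | zero => exact .blank_right (.left rfl (.blank_left (.left rfl (.blank_left (.left rfl .refl)))))
  | succ k =>
    rw [blocks_succ]
    have h := (reach_C_round_trip 1 (blocks k [1])).trans (reach_C_blocks k 5)
    rw [show 5 + 5 * k + 3 = 5 * (k + 1) + 3 by ring] at h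
    exact (Reach.blank_right (.left rfl h)).congr_steps (by ring)

theorem reach_of_mod_one (k : ℕ) :
    Reach (3 * k + 2) (some 0) [] (0 :: ones (3 * k + 1) [])
      (some 3) (1 :: blocks k [1]) [] := by
  rw [← ones_cons]
  exact (reach_A_blocks k [1]).trans (.right (t := 0) rfl .refl)

theorem reach_of_mod_two (k : ℕ) :
    Reach (10 * k ^ 2 + 26 * k + 12) (some 0) [] (0 :: ones (3 * k + 2) [])
      (some 0) [] (0 :: ones (5 * k + 7) []) := by
  rw [← ones_cons, ← ones_cons]
  have h := (reach_C_ones 3 1 (blocks k [1])).trans (reach_C_blocks k 4)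
  rw [show 4 + 5 * k + 3 = 5 * k + 7 by ring] at h
  exact ((reach_A_blocks k [1, 1]).trans (.right rfl (.right rfl (.blank_right (.right rfl
    (.blank_right (.right rfl (.blank_right (.left rfl h)))))))))
    |>.congr_steps (by ring)

theorem step_iterate_of_halted {n k : ℕ} {T : Machine n k} {c : Cfg n k} (h : c.state = none)
    (t : ℕ) : (step T)^[t] c = c :=
  Function.iterate_fixed (by simp [step, h]) t

theorem haltsIn_succ {n k : ℕ} {T : Machine n k} {c : Cfg n k} {t : ℕ}
    (h : ((step T)^[t + 1] c).state = none) (h' : ((step T)^[t] c).state ≠ none) :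
    HaltsIn T c (t + 1) := by
  refine ⟨h, fun i hi hn => h' ?_⟩
  obtain ⟨j, rfl⟩ := Nat.exists_eq_add_of_le (Nat.lt_succ_iff.mp hi)
  rw [add_comm, Function.iterate_add_apply, step_iterate_of_halted hn, hn]

theorem listCfg_halted (k : ℕ) (q : ℤ) :
    listCfg none (1 :: 1 :: blocks k [1]) [] (q + 3 * k + 3) =
      { state := none
        pos := q + 3 * k + 3
        tape := fun i =>
          if i = q ∨ (q + 1 ≤ i ∧ i ≤ q + 3 * k ∧ (i - q) % 3 ≠ 0) ∨
              i = q + 3 * k + 1 ∨ i = q + 3 * k + 2 then 1 else 0 } := by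
  simp only [listCfg, Cfg.mk.injEq, true_and]
  funext i
  rcases le_or_gt (q + 3 * k + 3) i with hi | hi
  · rw [if_pos hi, if_neg (by omega)]
    simp
  · rw [if_neg (by omega)]
    obtain ⟨j, rfl⟩ : ∃ j : ℕ, i = q + 3 * k + 2 - j := ⟨(q + 3 * k + 2 - i).toNat, by omega⟩
    rw [show (q + 3 * k + 3 - 1 - (q + 3 * k + 2 - (j : ℤ))).toNat = j by omega]
    match j with
    | 0 => simp
    | 1 =>
      rw [if_pos (by omega)]
      simp
    | j + 2 =>
      rw [List.getD_cons_succ, List.getD_cons_succ, getD_blocks]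
      exact if_congr (by omega) rfl rfl

/-- Michel's analysis of Marxen and Buntrock's runner-up: for every `k`,
`C(3k) ⊢(10k²+10k+4) C(5k+3)`, from `C(3k+1)` the machine halts in exactly `3k+3` steps
with final tape `…0 1 (110)^k 1 1 (H0) 0…`, and `C(3k+2) ⊢(10k²+26k+12) C(5k+7)`. -/
theorem marxen_buntrock_runner_up_analysis (k : ℕ) (p : ℤ) :
    (∃ q : ℤ, (step M)^[10 * k ^ 2 + 10 * k + 4] (Cf (3 * k) p) = Cf (5 * k + 3) q) ∧
    (HaltsIn M (Cf (3 * k + 1) p) (3 * k + 3) ∧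
      ∃ q : ℤ, (step M)^[3 * k + 3] (Cf (3 * k + 1) p) =
        { state := none
          pos := q + 3 * k + 3
          tape := fun i =>
            if i = q ∨ (q + 1 ≤ i ∧ i ≤ q + 3 * k ∧ (i - q) % 3 ≠ 0) ∨
                i = q + 3 * k + 1 ∨ i = q + 3 * k + 2 then 1 else 0 }) ∧
    (∃ q : ℤ, (step M)^[10 * k ^ 2 + 26 * k + 12] (Cf (3 * k + 2) p) = Cf (5 * k + 7) q) := by
  refine ⟨?_, ?_, ?_⟩
  · simp only [Cf_eq_listCfg]
    exact reach_of_mod_zero k p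
  · rw [Cf_eq_listCfg]
    obtain ⟨p', h⟩ := reach_of_mod_one k p
    have h' : (step M)^[3 * k + 3] (listCfg (some 0) [] (0 :: ones (3 * k + 1) []) p) =
        listCfg none (1 :: 1 :: blocks k [1]) [] (p' + 1) := by
      rw [Function.iterate_succ_apply', h, ← listCfg_append_blank_right]
      exact step_right rfl _ _ _
    refine ⟨haltsIn_succ (by rw [h']; rfl) (by rw [h]; simp [listCfg]), p' - 3 * k - 2, ?_⟩
    rw [h', ← listCfg_halted, show p' - 3 * k - 2 + 3 * k + 3 = p' + 1 by ring]
  · simp only [Cf_eq_listCfg]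
    exact reach_of_mod_two k p
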